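/- Let k be a positive integer. If two virtual knots K and K' are related by a finite sequence of 2k-moves, then their odd writhes satisfy J(K) ≡ J(K') (mod 2k). -/

import Mathlib

/-!
Combinatorial Gauss diagrams.

A Gauss diagram is encoded as a list of chord endpoints read along the
oriented circle from a basepoint.  Each endpoint records the (natural number)
label of its chord, whether it is the terminal endpoint of the (oriented)
chord, and the sign of the chord (`true` = +1, `false` = -1).
Diagrams are considered up to rotation of the basepoint and relabeling of the
chords; these renamings are included among the "Reidemeister" generators.
-/

structure Endpoint where
  label : ℕ
  isTerminal : Bool
  sign : Bool
deriving DecidableEq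

namespace Gauss

/-- The sign (±1) of the chord through an endpoint. -/
def signValue (e : Endpoint) : ℤ := if e.sign then 1 else -1

/-- The sign assigned to an endpoint: `ε` at the terminal endpoint and `-ε`
at the initial endpoint of a chord of sign `ε`. -/
def endpointValue (e : Endpoint) : ℤ := if e.isTerminal then signValue e else -signValue e

/-- The list of chord labels of the endpoints of a word. -/
def labels (L : List Endpoint) : List ℕ := L.map Endpoint.label

/-- A word is a Gauss diagram when every chord label occurring in it occurs
exactly twice, once as an initial and once as a terminal endpoint, with the
same sign at both occurrences. -/
def IsGaussDiagram (L : List Endpoint) : Prop :=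
  ∀ e ∈ L, (L.filter (fun x => x.label == e.label)).length = 2 ∧
    ∃ e' ∈ L, e'.label = e.label ∧ e'.isTerminal = !e.isTerminal ∧ e'.sign = e.sign

/-- Rotate a word so that the first endpoint satisfying `p` comes first. -/
def rotateTo (L : List Endpoint) (p : Endpoint → Bool) : List Endpoint :=
  match L.findIdx? p with
  | some i => L.drop i ++ L.take i
  | none => L

/-- The index of the chord labeled `c`: the sum of the signs assigned to the
endpoints on the arc running from the initial endpoint of the chord to its
terminal endpoint in the direction of the circle's orientation. -/
def chordIndex (L : List Endpoint) (c : ℕ) : ℤ :=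
  ((((rotateTo L (fun e => e.label == c && !e.isTerminal)).drop 1).takeWhile
      (fun e => e.label != c)).map endpointValue).sum

/-- `Jn L n`: the sum of the signs of the chords of `L` of index `n`. -/
def Jn (L : List Endpoint) (n : ℤ) : ℤ :=
  ((L.filter (fun e => e.isTerminal && decide (chordIndex L e.label = n))).map signValue).sum

/-- The odd writhe: the sum of the signs of the chords of odd index,
i.e. `J = Σ_{n odd} J_n`. -/
def oddWrithe (L : List Endpoint) : ℤ :=
  ((L.filter (fun e => e.isTerminal && decide (chordIndex L e.label % 2 ≠ 0))).map signValue).sum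

/-- Moving the basepoint of the circle. -/
def rotateStep (L L' : List Endpoint) : Prop :=
  ∃ x xs, L = x :: xs ∧ L' = xs ++ [x]

/-- Injective relabeling of the chords. -/
def relabelStep (L L' : List Endpoint) : Prop :=
  ∃ f : ℕ → ℕ, Function.Injective f ∧
    L' = L.map (fun e => Endpoint.mk (f e.label) e.isTerminal e.sign)

/-- Reidemeister move I (removal direction): remove an isolated chord whose
two endpoints are adjacent (either orientation, either sign). -/
def reid1 (L L' : List Endpoint) : Prop :=
  ∃ (A B : List Endpoint) (c : ℕ) (t s : Bool),
    c ∉ labels (A ++ B) ∧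
    L = A ++ [Endpoint.mk c t s, Endpoint.mk c (!t) s] ++ B ∧
    L' = A ++ B

/-- Reidemeister move II (removal direction): remove two chords of opposite
signs whose initial endpoints are adjacent and whose terminal endpoints are
adjacent (in either of the two admissible orders). -/
def reid2 (L L' : List Endpoint) : Prop :=
  ∃ (A B C : List Endpoint) (c d : ℕ) (s crossed : Bool),
    c ≠ d ∧ c ∉ labels (A ++ B ++ C) ∧ d ∉ labels (A ++ B ++ C) ∧
    L = A ++ [Endpoint.mk c false s, Endpoint.mk d false (!s)] ++ B ++
        (if crossed then [Endpoint.mk c true s, Endpoint.mk d true (!s)]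
         else [Endpoint.mk d true (!s), Endpoint.mk c true s]) ++ C ∧
    L' = A ++ B ++ C

/-- Reidemeister move III (a standard variant; together with the moves I, II,
rotations and relabelings it generates all versions of the third move). -/
def reid3 (L L' : List Endpoint) : Prop :=
  ∃ (A B C D : List Endpoint) (a b c : ℕ) (s : Bool),
    a ≠ b ∧ b ≠ c ∧ a ≠ c ∧
    L = A ++ [Endpoint.mk b false s, Endpoint.mk a false s] ++ B ++
        [Endpoint.mk a true s, Endpoint.mk c false (!s)] ++ C ++
        [Endpoint.mk b true s, Endpoint.mk c true (!s)] ++ D ∧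
    L' = A ++ [Endpoint.mk a false s, Endpoint.mk b false s] ++ B ++
        [Endpoint.mk c false (!s), Endpoint.mk a true s] ++ C ++
        [Endpoint.mk c true (!s), Endpoint.mk b true s] ++ D

/-- A single Reidemeister generator (including diagram renamings). -/
def reidStep (L L' : List Endpoint) : Prop :=
  rotateStep L L' ∨ relabelStep L L' ∨ reid1 L L' ∨ reid2 L L' ∨ reid3 L L'

/-- A Ξ-move: exchange the first and third of three consecutive endpoints
belonging to three distinct chords, keeping all signs and orientations. -/
def xiStep (L L' : List Endpoint) : Prop :=
  ∃ (A B : List Endpoint) (x y z : Endpoint),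
    x.label ≠ y.label ∧ y.label ≠ z.label ∧ x.label ≠ z.label ∧
    L = A ++ [x, y, z] ++ B ∧
    L' = A ++ [z, y, x] ++ B

/-- A 2k-move (removal direction): remove `2k` chords `c 0, …, c (2k-1)`, all
of sign `s`, whose `p`-endpoints appear consecutively on one arc and whose
`q`-endpoints appear consecutively on a disjoint arc, the chord `c i` being
oriented from `p` to `q` for even `i` (the paper's odd `i`, 1-indexed) and
from `q` to `p` for odd `i`, so initial and terminal endpoints alternate. -/
def move2k (k : ℕ) (L L' : List Endpoint) : Prop :=
  ∃ (A B C : List Endpoint) (c : ℕ → ℕ) (s : Bool),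
    (∀ i < 2 * k, ∀ j < 2 * k, c i = c j → i = j) ∧
    (∀ i < 2 * k, c i ∉ labels (A ++ B ++ C)) ∧
    L = A ++ (List.range (2 * k)).map (fun i => Endpoint.mk (c i) (decide (i % 2 = 1)) s)
          ++ B ++
        (List.range (2 * k)).map (fun i => Endpoint.mk (c i) (decide (i % 2 = 0)) s)
          ++ C ∧
    L' = A ++ B ++ C

/-- A crossing change: reverse the sign and the orientation of one chord. -/
def crossingChange (L L' : List Endpoint) : Prop :=
  ∃ c : ℕ,
    L' = L.map (fun e =>
      if e.label = c then Endpoint.mk e.label (!e.isTerminal) (!e.sign) else e)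

/-- Finite sequences of moves from `r`, performed in either direction. -/
def Moves (r : List Endpoint → List Endpoint → Prop) :
    List Endpoint → List Endpoint → Prop :=
  Relation.ReflTransGen (fun L L' => r L L' ∨ r L' L)

/-- Related by Reidemeister moves: the two words represent the same virtual knot. -/
def ReidEquiv : List Endpoint → List Endpoint → Prop := Moves reidStep

/-- Related by a finite sequence of 2k-moves (and Reidemeister moves). -/
def Rel2k (k : ℕ) : List Endpoint → List Endpoint → Prop :=
  Moves (fun L L' => reidStep L L' ∨ move2k k L L')

/-- Related by a finite sequence of Ξ-moves (and Reidemeister moves). -/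
def RelXi : List Endpoint → List Endpoint → Prop :=
  Moves (fun L L' => reidStep L L' ∨ xiStep L L')

/-- Related by a finite sequence of 2k-moves and Ξ-moves (and Reidemeister moves). -/
def Rel2kXi (k : ℕ) : List Endpoint → List Endpoint → Prop :=
  Moves (fun L L' => reidStep L L' ∨ move2k k L L' ∨ xiStep L L')

/-- Related by a finite sequence of crossing changes and Ξ-moves
(and Reidemeister moves). -/
def RelCCXi : List Endpoint → List Endpoint → Prop :=
  Moves (fun L L' => reidStep L L' ∨ crossingChange L L' ∨ xiStep L L')

/-- A shell-pair of sign `s`: two chords `c`, `d` of sign `s` whose four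
endpoints are consecutive, interleaved as 1st-3rd and 2nd-4th
(with arbitrary orientations `t`, `u` of the two shells). -/
def shellPair (c d : ℕ) (t u s : Bool) : List Endpoint :=
  [Endpoint.mk c t s, Endpoint.mk d u s, Endpoint.mk c (!t) s, Endpoint.mk d (!u) s]

/-- The Gauss diagram `G(a)`: `|a|` consecutive shell-pairs of sign `+1` if
`a > 0` and of sign `-1` if `a < 0`; `G(0)` has no chords.  It represents the
virtual knot `K(a)`. -/
def Gword (a : ℤ) : List Endpoint :=
  ((List.range a.natAbs).map
    (fun j => shellPair (2 * j) (2 * j + 1) false false (decide (0 < a)))).flatten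

/-- `Rel2kCount k m G G'`: `G` and `G'` are related by a finite sequence of
Reidemeister moves and exactly `m` 2k-moves. -/
inductive Rel2kCount (k : ℕ) : ℕ → List Endpoint → List Endpoint → Prop
  | refl (L : List Endpoint) : Rel2kCount k 0 L L
  | reid {m : ℕ} {L L' L'' : List Endpoint} :
      reidStep L L' ∨ reidStep L' L →
      Rel2kCount k m L' L'' → Rel2kCount k m L L''
  | move {m : ℕ} {L L' L'' : List Endpoint} :
      move2k k L L' ∨ move2k k L' L →
      Rel2kCount k m L' L'' → Rel2kCount k (m + 1) L L''

/-- The 2k-move distance: the minimal number of 2k-moves needed to relate the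
two diagrams (together with Reidemeister moves). -/
noncomputable def dist2k (k : ℕ) (L L' : List Endpoint) : ℕ :=
  sInf {m | Rel2kCount k m L L'}

end Gauss

namespace Gauss

/-- Alternating sum over positions of the occurrences of the label `c`. -/
def altSum (c : ℕ) : List Endpoint → ℤ
  | [] => 0
  | e :: L => (if e.label = c then 1 else 0) - altSum c L

/-- sign at terminal endpoints, zero at initial endpoints. -/
def tv (e : Endpoint) : ℤ := if e.isTerminal then signValue e else 0

def Qf (f : ℕ → ℤ) (L : List Endpoint) : ℤ := (L.map (fun e => tv e * f e.label)).sum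

/-- Four times the odd writhe, for Gauss diagrams. -/
def Q (L : List Endpoint) : ℤ := Qf (fun c => altSum c L ^ 2) L

lemma altSum_append (c : ℕ) (A B : List Endpoint) :
    altSum c (A ++ B) = altSum c A + (-1) ^ A.length * altSum c B := by
  induction A with
  | nil => simp [altSum]
  | cons x A ih => simp [altSum, ih, pow_succ]; ring

lemma altSum_notMem (c : ℕ) (A : List Endpoint) (h : c ∉ labels A) : altSum c A = 0 := by
  induction A with
  | nil => simp [altSum]
  | cons x A ih =>
    simp only [labels, List.map_cons, List.mem_cons, not_or] at h
    simp [altSum, ih h.2, Ne.symm h.1]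

lemma Qf_append (f : ℕ → ℤ) (A B : List Endpoint) : Qf f (A ++ B) = Qf f A + Qf f B := by
  simp [Qf]

lemma Qf_perm (f : ℕ → ℤ) {A B : List Endpoint} (h : A.Perm B) : Qf f A = Qf f B :=
  (h.map _).sum_eq

lemma Qf_congr {f g : ℕ → ℤ} {A : List Endpoint} (h : ∀ c ∈ labels A, f c = g c) :
    Qf f A = Qf g A := by
  unfold Qf
  congr 1
  apply List.map_congr_left
  intro e he
  rw [h e.label (List.mem_map_of_mem he)]

lemma mem_labels_append {c : ℕ} {A B : List Endpoint} :
    c ∈ labels (A ++ B) ↔ c ∈ labels A ∨ c ∈ labels B := by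
  simp only [labels, List.map_append, List.mem_append]

lemma filter_len (L : List Endpoint) (c : ℕ) :
    (L.filter (fun x => x.label == c)).length = (labels L).count c := by
  rw [labels, List.count, List.countP_map, List.countP_eq_length_filter]
  rfl

lemma gauss_iff (L : List Endpoint) : IsGaussDiagram L ↔
    ∀ e ∈ L, (labels L).count e.label = 2 ∧
    ∃ e' ∈ L, e'.label = e.label ∧ e'.isTerminal = !e.isTerminal ∧ e'.sign = e.sign := by
  unfold IsGaussDiagram
  simp only [filter_len]

lemma gauss_count {L : List Endpoint} (h : IsGaussDiagram L) {c : ℕ} (hc : c ∈ labels L) :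
    (labels L).count c = 2 := by
  obtain ⟨e, he, rfl⟩ := List.mem_map.1 hc
  exact ((gauss_iff L).1 h e he).1

lemma gauss_even {L : List Endpoint} (h : IsGaussDiagram L) : Even L.length := by
  have h1 : (labels L).length = ∑ a ∈ (labels L).toFinset, (labels L).count a :=
    (List.sum_toFinset_count_eq_length (labels L)).symm
  have h2 : ∑ a ∈ (labels L).toFinset, (labels L).count a
      = ∑ a ∈ (labels L).toFinset, 2 :=
    Finset.sum_congr rfl (fun a ha => gauss_count h (List.mem_toFinset.1 ha))
  rw [h2, Finset.sum_const, smul_eq_mul] at h1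
  rw [labels, List.length_map] at h1
  rw [h1]
  simp

lemma gauss_perm {L L' : List Endpoint} (p : L.Perm L') (h : IsGaussDiagram L) :
    IsGaussDiagram L' := by
  rw [gauss_iff] at h ⊢
  intro e he
  obtain ⟨h1, e', he', h2⟩ := h e (p.mem_iff.2 he)
  refine ⟨?_, e', p.mem_iff.1 he', h2⟩
  rw [← h1]
  exact ((p.map _).count_eq _).symm

lemma gauss_append {M N : List Endpoint} (hM : IsGaussDiagram M)
    (hd : ∀ c ∈ labels M, c ∉ labels N) :
    IsGaussDiagram (M ++ N) ↔ IsGaussDiagram N := by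
  have hl : labels (M ++ N) = labels M ++ labels N := by simp [labels]
  rw [gauss_iff, gauss_iff, hl]
  rw [gauss_iff] at hM
  constructor
  · intro h e he
    have heN : e.label ∈ labels N := List.mem_map_of_mem he
    have heM : e.label ∉ labels M := fun hh => hd _ hh heN
    obtain ⟨h1, e', he', h2⟩ := h e (List.mem_append_right _ he)
    rw [List.count_append, List.count_eq_zero_of_not_mem heM, zero_add] at h1
    refine ⟨h1, e', ?_, h2⟩
    rcases List.mem_append.1 he' with h3 | h3
    · exact absurd (h2.1 ▸ List.mem_map_of_mem h3) heM
    · exact h3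
  · intro h e he
    rw [List.count_append]
    rcases List.mem_append.1 he with he | he
    · obtain ⟨h1, e', he', h2⟩ := hM e he
      have : e.label ∉ labels N := hd _ (List.mem_map_of_mem he)
      rw [List.count_eq_zero_of_not_mem this]
      exact ⟨h1, e', List.mem_append_left _ he', h2⟩
    · obtain ⟨h1, e', he', h2⟩ := h e he
      have : e.label ∉ labels M := fun hh => hd _ hh (List.mem_map_of_mem he)
      rw [List.count_eq_zero_of_not_mem this, zero_add]
      exact ⟨h1, e', List.mem_append_right _ he', h2⟩

lemma altSum_sq_pair {c : ℕ} {A B C : List Endpoint} {x y : Endpoint}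
    (hx : x.label = c) (hy : y.label = c)
    (hA : c ∉ labels A) (hB : c ∉ labels B) (hC : c ∉ labels C) :
    altSum c (A ++ x :: (B ++ y :: C)) ^ 2 = if B.length % 2 = 0 then 0 else 4 := by
  have : altSum c (A ++ x :: (B ++ y :: C)) = (-1) ^ A.length * (1 - (-1) ^ B.length) := by
    simp [altSum_append, altSum, hx, hy, altSum_notMem c A hA, altSum_notMem c B hB,
      altSum_notMem c C hC]
  rw [this, mul_pow, ← pow_mul, mul_comm A.length 2, pow_mul]
  split_ifs with h
  · rw [(Nat.even_iff.2 h).neg_one_pow]; norm_num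
  · rw [(Nat.odd_iff.2 (Nat.mod_two_ne_zero.1 h)).neg_one_pow]; norm_num

lemma sum_parity (B : List Endpoint) :
    ((B.map endpointValue).sum) % 2 = (B.length : ℤ) % 2 := by
  induction B with
  | nil => rfl
  | cons x B ih =>
    have : endpointValue x = 1 ∨ endpointValue x = -1 := by
      unfold endpointValue signValue
      split_ifs <;> simp
    simp only [List.map_cons, List.sum_cons, List.length_cons, Nat.cast_add, Nat.cast_one]
    rcases this with h | h <;> rw [h] <;> omega

lemma takeWhile_aux {c : ℕ} {B C : List Endpoint} {y : Endpoint} (hB : c ∉ labels B)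
    (hy : y.label = c) :
    (B ++ y :: C).takeWhile (fun e => e.label != c) = B := by
  rw [List.takeWhile_append_of_pos]
  · simp [hy]
  · intro e he
    simp only [bne_iff_ne]
    rintro rfl
    exact hB (List.mem_map_of_mem he)

lemma rotateTo_aux {P R : List Endpoint} {x : Endpoint} {p : Endpoint → Bool}
    (hP : ∀ e ∈ P, p e = false) (hx : p x = true) :
    rotateTo (P ++ x :: R) p = x :: (R ++ P) := by
  have : (P ++ x :: R).findIdx? p = some P.length := by
    rw [List.findIdx?_append, List.findIdx?_eq_none_iff.2 hP]
    simp [List.findIdx?_cons, hx]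
  simp [rotateTo, this]

lemma split_two {c : ℕ} {L : List Endpoint} (h : (labels L).count c = 2) :
    ∃ A B C : List Endpoint, ∃ x y : Endpoint, L = A ++ x :: (B ++ y :: C) ∧ x.label = c ∧
      y.label = c ∧ c ∉ labels A ∧ c ∉ labels B ∧ c ∉ labels C := by
  have key : ∀ L : List Endpoint, c ∈ labels L →
      ∃ A R : List Endpoint, ∃ x : Endpoint, L = A ++ x :: R ∧ x.label = c ∧ c ∉ labels A := by
    intro L
    induction L with
    | nil => intro h; simp [labels] at h
    | cons z L ih =>
      intro h
      by_cases hz : z.label = c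
      · exact ⟨[], L, z, by simp, hz, by simp [labels]⟩
      · have : c ∈ labels L := by
          simp only [labels, List.map_cons, List.mem_cons] at h ⊢
          rcases h with h | h
          · exact absurd h.symm hz
          · exact h
        obtain ⟨A, R, x, h1, h2, h3⟩ := ih this
        refine ⟨z :: A, R, x, by simp [h1], h2, ?_⟩
        simp only [labels, List.map_cons, List.mem_cons, not_or]
        exact ⟨fun h => hz h.symm, h3⟩
  obtain ⟨A, R, x, rfl, hx, hA⟩ := key L (List.count_pos_iff.1 (by omega))
  have hl : labels (A ++ x :: R) = labels A ++ x.label :: labels R := by simp [labels]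
  rw [hl, List.count_append, List.count_eq_zero_of_not_mem hA, hx, List.count_cons_self] at h
  obtain ⟨B, C, y, rfl, hy, hB⟩ := key R (List.count_pos_iff.1 (by omega))
  have hl : labels (B ++ y :: C) = labels B ++ y.label :: labels C := by simp [labels]
  rw [hl, List.count_append, List.count_eq_zero_of_not_mem hB, hy, List.count_cons_self] at h
  exact ⟨A, B, C, x, y, rfl, hx, hy, hA, hB, List.count_eq_zero.1 (by omega)⟩

lemma index_parity {L : List Endpoint} (h : IsGaussDiagram L) {e : Endpoint} (he : e ∈ L) :
    altSum e.label L ^ 2 = if chordIndex L e.label % 2 ≠ 0 then 4 else 0 := by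
  have hev := gauss_even h
  obtain ⟨h1, e', he', h2, h3, -⟩ := (gauss_iff L).1 h e he
  generalize hc : e.label = c at *
  obtain ⟨A, B, C, x, y, rfl, hx, hy, hA, hB, hC⟩ := split_two h1
  have nm : ∀ z : Endpoint, z.label = c → z ∈ A ++ x :: (B ++ y :: C) → z = x ∨ z = y := by
    intro z hz hm
    have n1 : z ∉ A := fun hh => hA (hz ▸ List.mem_map_of_mem hh)
    have n2 : z ∉ B := fun hh => hB (hz ▸ List.mem_map_of_mem hh)
    have n3 : z ∉ C := fun hh => hC (hz ▸ List.mem_map_of_mem hh)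
    simpa [n1, n2, n3] using hm
  have ht : y.isTerminal = !x.isTerminal := by
    rcases nm e hc he with rfl | rfl <;> rcases nm e' h2 he' with rfl | rfl <;> simp_all
  rw [altSum_sq_pair hx hy hA hB hC]
  have fA : ∀ z ∈ A, (z.label == c && !z.isTerminal) = false := by
    intro z hz
    have : z.label ≠ c := fun hh => hA (hh ▸ List.mem_map_of_mem hz)
    simp [this]
  have fB : ∀ z ∈ B, (z.label == c && !z.isTerminal) = false := by
    intro z hz
    have : z.label ≠ c := fun hh => hB (hh ▸ List.mem_map_of_mem hz)
    simp [this]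
  have par : chordIndex (A ++ x :: (B ++ y :: C)) c % 2 = (B.length : ℤ) % 2 := by
    unfold chordIndex
    cases hxt : x.isTerminal
    · rw [rotateTo_aux fA (by simp [hx, hxt])]
      have : (x :: (B ++ y :: C ++ A)).drop 1 = B ++ y :: (C ++ A) := by simp
      rw [this, takeWhile_aux hB hy, sum_parity]
    · have e1 : A ++ x :: (B ++ y :: C) = (A ++ x :: B) ++ y :: C := by simp
      rw [e1, rotateTo_aux]
      · have : (y :: (C ++ (A ++ x :: B))).drop 1 = (C ++ A) ++ x :: B := by simp
        rw [this, takeWhile_aux _ hx, sum_parity]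
        · simp only [List.length_append, List.length_cons] at hev ⊢
          rw [Nat.even_iff] at hev
          omega
        · rw [mem_labels_append]; tauto
      · intro z hz
        simp only [List.mem_append, List.mem_cons] at hz
        rcases hz with hz | rfl | hz
        · exact fA z hz
        · simp [hxt]
        · exact fB z hz
      · simp [hy, ht, hxt]
  rw [par]
  split_ifs <;> first | rfl | omega

lemma four_oddWrithe {L : List Endpoint} (h : IsGaussDiagram L) : 4 * oddWrithe L = Q L := by
  have key : ∀ M : List Endpoint, (∀ e ∈ M, e ∈ L) →
      4 * ((M.filter (fun e => e.isTerminal && decide (chordIndex L e.label % 2 ≠ 0))).map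
        signValue).sum = Qf (fun c => altSum c L ^ 2) M := by
    intro M
    induction M with
    | nil => intro _; simp [Qf]
    | cons x M ih =>
      intro hM
      have ih := ih (fun e he => hM e (List.mem_cons_of_mem _ he))
      have hp := index_parity h (hM x List.mem_cons_self)
      have : Qf (fun c => altSum c L ^ 2) (x :: M)
          = tv x * altSum x.label L ^ 2 + Qf (fun c => altSum c L ^ 2) M := by simp [Qf]
      rw [this, ← ih, hp, List.filter_cons]
      unfold tv
      by_cases h1 : x.isTerminal = true <;> by_cases h2 : chordIndex L x.label % 2 = 0 <;>
        simp [h1, h2]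
      ring
  exact key L (fun _ h => h)

/-- Inserting even-length blocks of fresh chords. -/
lemma Q_insert {A B C M N : List Endpoint} (hM : Even M.length) (hN : Even N.length)
    (hd : ∀ c ∈ labels (M ++ N), c ∉ labels (A ++ B ++ C)) :
    Q (A ++ M ++ B ++ N ++ C) =
      Q (A ++ B ++ C) + Qf (fun c => altSum c (A ++ M ++ B ++ N ++ C) ^ 2) (M ++ N) := by
  have p : (A ++ M ++ B ++ N ++ C).Perm ((A ++ B ++ C) ++ (M ++ N)) := by
    rw [← Multiset.coe_eq_coe]
    simp only [← Multiset.coe_add]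
    abel
  unfold Q
  rw [Qf_perm _ p, Qf_append]
  congr 1
  apply Qf_congr
  intro c hc
  have h1 : c ∉ labels M := fun hh => hd c (mem_labels_append.2 (Or.inl hh)) hc
  have h2 : c ∉ labels N := fun hh => hd c (mem_labels_append.2 (Or.inr hh)) hc
  simp [altSum_append, altSum_notMem c M h1, altSum_notMem c N h2, pow_add,
    hM.neg_one_pow, hN.neg_one_pow]

lemma gauss_insert {A B C M N : List Endpoint} (hG : IsGaussDiagram (M ++ N))
    (hd : ∀ c ∈ labels (M ++ N), c ∉ labels (A ++ B ++ C)) :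
    IsGaussDiagram (A ++ M ++ B ++ N ++ C) ↔ IsGaussDiagram (A ++ B ++ C) := by
  have p : (A ++ M ++ B ++ N ++ C).Perm ((M ++ N) ++ (A ++ B ++ C)) := by
    rw [← Multiset.coe_eq_coe]
    simp only [← Multiset.coe_add]
    abel
  rw [← gauss_append hG hd]
  exact ⟨gauss_perm p, gauss_perm p.symm⟩

/-- The invariance property of a single step. -/
def Good (k : ℕ) (L L' : List Endpoint) : Prop :=
  (IsGaussDiagram L ↔ IsGaussDiagram L') ∧
    (IsGaussDiagram L → Q L ≡ Q L' [ZMOD (8 * k : ℤ)])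

lemma good_rotate (k : ℕ) {L L' : List Endpoint} (h : rotateStep L L') : Good k L L' := by
  obtain ⟨x, xs, rfl, rfl⟩ := h
  have p : (x :: xs).Perm (xs ++ [x]) := (List.perm_append_singleton x xs).symm
  refine ⟨⟨gauss_perm p, gauss_perm p.symm⟩, fun hg => ?_⟩
  have hev := gauss_even hg
  have hodd : Odd xs.length := by
    rw [List.length_cons, Nat.even_iff] at hev
    rw [Nat.odd_iff]; omega
  have : Q (x :: xs) = Q (xs ++ [x]) := by
    unfold Q
    rw [Qf_perm _ p]
    apply Qf_congr
    intro c _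
    simp only [altSum_append, altSum, hodd.neg_one_pow]
    ring
  rw [this]

lemma good_relabel (k : ℕ) {L L' : List Endpoint} (h : relabelStep L L') : Good k L L' := by
  obtain ⟨f, hf, rfl⟩ := h
  have hl : labels (L.map (fun e => Endpoint.mk (f e.label) e.isTerminal e.sign))
      = (labels L).map f := by
    simp [labels]
  refine ⟨?_, fun _ => ?_⟩
  · rw [gauss_iff, gauss_iff, hl]
    simp only [List.mem_map, exists_exists_and_eq_and, forall_exists_index, and_imp, forall_apply_eq_imp_iff₂, hf.eq_iff,
      List.count_map_of_injective _ f hf]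
  · have ha : ∀ c, ∀ M : List Endpoint,
        altSum (f c) (M.map (fun e => Endpoint.mk (f e.label) e.isTerminal e.sign))
        = altSum c M := by
      intro c M
      induction M with
      | nil => rfl
      | cons x M ih => simp only [List.map_cons, altSum, ih, hf.eq_iff]
    have : Q (L.map (fun e => Endpoint.mk (f e.label) e.isTerminal e.sign)) = Q L := by
      unfold Q Qf
      rw [List.map_map]
      congr 1
      apply List.map_congr_left
      intro e _
      simp only [Function.comp, ha]
      rfl
    rw [this]

lemma good_reid1 (k : ℕ) {L L' : List Endpoint} (h : reid1 L L') : Good k L L' := by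
  obtain ⟨A, B, c, t, s, hc, rfl, rfl⟩ := h
  have hd : ∀ d ∈ labels ([Endpoint.mk c t s, Endpoint.mk c (!t) s] ++ []),
      d ∉ labels (A ++ [] ++ B) := by
    simpa [labels] using hc
  have hg : IsGaussDiagram ([Endpoint.mk c t s, Endpoint.mk c (!t) s] ++ []) := by
    rw [gauss_iff]; simp [labels]
  have h1 := gauss_insert hg hd
  have h2 := Q_insert (by simp) (by simp) hd
  simp only [List.append_nil] at h1 h2
  refine ⟨h1, fun _ => ?_⟩
  have hA : c ∉ labels A := fun hh => hc (mem_labels_append.2 (Or.inl hh))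
  have hB : c ∉ labels B := fun hh => hc (mem_labels_append.2 (Or.inr hh))
  have : altSum c (A ++ [Endpoint.mk c t s, Endpoint.mk c (!t) s] ++ B) = 0 := by
    simp [altSum_append, altSum, altSum_notMem c A hA, altSum_notMem c B hB]
  rw [h2]
  have h3 : ∀ f : ℕ → ℤ, f c = 0 → Qf f [Endpoint.mk c t s, Endpoint.mk c (!t) s] = 0 := by
    intro f hf
    simp [Qf, hf]
  rw [h3 _ (by rw [this]; rfl), add_zero]

lemma good_reid2 (k : ℕ) {L L' : List Endpoint} (h : reid2 L L') : Good k L L' := by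
  obtain ⟨A, B, C, c, d, s, cr, hcd, hc, hd', rfl, rfl⟩ := h
  have hdc := hcd.symm
  set N := (if cr then [Endpoint.mk c true s, Endpoint.mk d true (!s)]
         else [Endpoint.mk d true (!s), Endpoint.mk c true s]) with hN
  set M := [Endpoint.mk c false s, Endpoint.mk d false (!s)] with hM
  have hd : ∀ x ∈ labels (M ++ N), x ∉ labels (A ++ B ++ C) := by
    intro x hx
    have : x = c ∨ x = d := by
      cases cr <;> simp [labels, hM, hN] at hx <;> tauto
    rcases this with rfl | rfl <;> assumption
  have hg : IsGaussDiagram (M ++ N) := by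
    rw [gauss_iff]; cases cr <;> simp [labels, hM, hN, hcd, hdc, List.count_cons]
  refine ⟨gauss_insert hg hd, fun _ => ?_⟩
  rw [Q_insert (by simp [hM]) (by cases cr <;> simp [hN]) hd]
  simp only [mem_labels_append, not_or] at hc hd'
  have e : altSum c (A ++ M ++ B ++ N ++ C) ^ 2 = altSum d (A ++ M ++ B ++ N ++ C) ^ 2 := by
    cases cr <;>
    simp [altSum_append, altSum, hM, hN, hcd, hdc, altSum_notMem _ _ hc.1.1,
      altSum_notMem _ _ hc.1.2, altSum_notMem _ _ hc.2, altSum_notMem _ _ hd'.1.1,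
      altSum_notMem _ _ hd'.1.2, altSum_notMem _ _ hd'.2, pow_add] <;> ring
  have : Qf (fun x => altSum x (A ++ M ++ B ++ N ++ C) ^ 2) (M ++ N) = 0 := by
    have : ∀ f : ℕ → ℤ, f c = f d → Qf f (M ++ N) = 0 := by
      intro f hf
      cases cr <;> cases s <;> simp [Qf, hM, hN, tv, signValue, hf]
    exact this _ e
  rw [this, add_zero]

lemma good_reid3 (k : ℕ) {L L' : List Endpoint} (h : reid3 L L') : Good k L L' := by
  obtain ⟨A, B, C, D, a, b, c, s, hab, hbc, hac, rfl, rfl⟩ := h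
  have sw : ∀ x y : Endpoint, [x, y].Perm [y, x] := fun x y => List.Perm.swap _ _ _
  have p : (A ++ [Endpoint.mk b false s, Endpoint.mk a false s] ++ B ++
        [Endpoint.mk a true s, Endpoint.mk c false (!s)] ++ C ++
        [Endpoint.mk b true s, Endpoint.mk c true (!s)] ++ D).Perm
      (A ++ [Endpoint.mk a false s, Endpoint.mk b false s] ++ B ++
        [Endpoint.mk c false (!s), Endpoint.mk a true s] ++ C ++
        [Endpoint.mk c true (!s), Endpoint.mk b true s] ++ D) := by
    refine List.Perm.append_right _ (List.Perm.append ?_ (sw _ _))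
    refine List.Perm.append_right _ (List.Perm.append ?_ (sw _ _))
    refine List.Perm.append_right _ (List.Perm.append_left _ (sw _ _))
  refine ⟨⟨gauss_perm p, gauss_perm p.symm⟩, fun hg => ?_⟩
  have ca := gauss_count hg (c := a) (by simp [labels])
  have cb := gauss_count hg (c := b) (by simp [labels])
  have cc := gauss_count hg (c := c) (by simp [labels])
  have hba := hab.symm
  have hcb := hbc.symm
  have hca := hac.symm
  have hlab : ∀ X Y, labels (X ++ Y) = labels X ++ labels Y := fun X Y => by simp [labels]
  have h2 : ∀ x y, labels [x, y] = [x.label, y.label] := fun x y => by simp [labels]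
  simp only [hlab, h2, List.count_append, List.count_cons, List.count_nil, beq_iff_eq, hab, hba,
    hbc, hcb, hac, hca, if_true, if_false] at ca cb cc
  have z : ∀ {x : ℕ} {X : List Endpoint}, (labels X).count x = 0 → altSum x X = 0 :=
    fun h => altSum_notMem _ _ (List.count_eq_zero.1 h)
  have aA := z (x := a) (X := A) (by omega)
  have aB := z (x := a) (X := B) (by omega)
  have aC := z (x := a) (X := C) (by omega)
  have aD := z (x := a) (X := D) (by omega)
  have bA := z (x := b) (X := A) (by omega)
  have bB := z (x := b) (X := B) (by omega)
  have bC := z (x := b) (X := C) (by omega)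
  have bD := z (x := b) (X := D) (by omega)
  have cA := z (x := c) (X := A) (by omega)
  have cB := z (x := c) (X := B) (by omega)
  have cC := z (x := c) (X := C) (by omega)
  have cD := z (x := c) (X := D) (by omega)
  have : ∀ L L' : List Endpoint, L.Perm L' →
      (∀ x, altSum x L ^ 2 = altSum x L' ^ 2) → Q L = Q L' := by
    intro L L' hp hq
    unfold Q
    rw [Qf_perm _ hp]
    exact Qf_congr (fun x _ => hq x)
  rw [this _ _ p]
  intro x
  by_cases hxa : x = a
  · subst hxa
    simp [altSum_append, altSum, aA, aB, aC, aD, hab, hba, hbc, hcb, hac, hca, pow_add]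
    ring
  by_cases hxb : x = b
  · subst hxb
    simp [altSum_append, altSum, bA, bB, bC, bD, hab, hba, hbc, hcb, hac, hca, pow_add]
    ring
  by_cases hxc : x = c
  · subst hxc
    simp [altSum_append, altSum, cA, cB, cC, cD, hab, hba, hbc, hcb, hac, hca, pow_add]
    ring
  simp [altSum_append, altSum, Ne.symm hxa, Ne.symm hxb, Ne.symm hxc, pow_add]

lemma altSum_range (c : ℕ → ℕ) (t : ℕ → Bool) (s : Bool) (x n : ℕ) :
    altSum x ((List.range n).map (fun i => Endpoint.mk (c i) (t i) s))
      = ∑ i ∈ Finset.range n, if c i = x then (-1) ^ i else 0 := by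
  induction n with
  | zero => simp [altSum]
  | succ n ih =>
    rw [List.range_succ, List.map_append, altSum_append, ih, Finset.sum_range_succ]
    simp [altSum]

lemma labels_range (c : ℕ → ℕ) (t : ℕ → Bool) (s : Bool) (n : ℕ) :
    labels ((List.range n).map (fun i => Endpoint.mk (c i) (t i) s)) = (List.range n).map c := by
  simp [labels]

lemma Qf_range (f : ℕ → ℤ) (c : ℕ → ℕ) (s : Bool) (v : ℤ) (n : ℕ)
    (hf : ∀ i < n, f (c i) = v) :
    Qf f ((List.range n).map (fun i => Endpoint.mk (c i) (decide (i % 2 = 1)) s)) +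
    Qf f ((List.range n).map (fun i => Endpoint.mk (c i) (decide (i % 2 = 0)) s))
      = n * ((if s then 1 else -1) * v) := by
  induction n with
  | zero => simp [Qf]
  | succ n ih =>
    have ih := ih (fun i hi => hf i (by omega))
    have hn := hf n (by omega)
    simp only [List.range_succ, List.map_append, Qf_append]
    have : Qf f ([n].map (fun i => Endpoint.mk (c i) (decide (i % 2 = 1)) s)) +
      Qf f ([n].map (fun i => Endpoint.mk (c i) (decide (i % 2 = 0)) s))
        = (if s then 1 else -1) * v := by
      rcases Nat.mod_two_eq_zero_or_one n with h | h <;> simp [Qf, tv, signValue, hn, h]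
    push_cast
    linear_combination ih + this

lemma good_move2k (k : ℕ) {L L' : List Endpoint} (h : move2k k L L') : Good k L L' := by
  obtain ⟨A, B, C, c, s, hinj, hfresh, rfl, rfl⟩ := h
  set M := (List.range (2 * k)).map (fun i => Endpoint.mk (c i) (decide (i % 2 = 1)) s) with hM
  set N := (List.range (2 * k)).map (fun i => Endpoint.mk (c i) (decide (i % 2 = 0)) s) with hN
  have lM : labels M = (List.range (2 * k)).map c := labels_range _ _ _ _
  have lN : labels N = (List.range (2 * k)).map c := labels_range _ _ _ _
  have nod : ((List.range (2 * k)).map c).Nodup := by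
    refine List.Nodup.map_on ?_ List.nodup_range
    intro i hi j hj hij
    exact hinj i (List.mem_range.1 hi) j (List.mem_range.1 hj) hij
  have hd : ∀ x ∈ labels (M ++ N), x ∉ labels (A ++ B ++ C) := by
    intro x hx
    rw [mem_labels_append, lM, lN, or_self, List.mem_map] at hx
    obtain ⟨i, hi, rfl⟩ := hx
    exact hfresh i (List.mem_range.1 hi)
  have hg : IsGaussDiagram (M ++ N) := by
    rw [gauss_iff]
    intro e he
    have hl : labels (M ++ N) = (List.range (2 * k)).map c ++ (List.range (2 * k)).map c := by
      rw [← lM]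
      nth_rewrite 2 [lM]
      rw [← lN]
      simp [labels]
    constructor
    · have : e.label ∈ (List.range (2 * k)).map c := by
        have := List.mem_map_of_mem (f := Endpoint.label) he
        change _ ∈ labels (M ++ N) at this
        rwa [hl, List.mem_append, or_self] at this
      rw [hl, List.count_append, List.count_eq_one_of_mem nod this]
    · rcases List.mem_append.1 he with he | he
      · obtain ⟨i, hi, rfl⟩ := List.mem_map.1 he
        refine ⟨_, List.mem_append_right _ (List.mem_map_of_mem hi), rfl, ?_, rfl⟩
        rcases Nat.mod_two_eq_zero_or_one i with h | h <;> simp [h]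
      · obtain ⟨i, hi, rfl⟩ := List.mem_map.1 he
        refine ⟨_, List.mem_append_left _ (List.mem_map_of_mem hi), rfl, ?_, rfl⟩
        rcases Nat.mod_two_eq_zero_or_one i with h | h <;> simp [h]
  refine ⟨gauss_insert hg hd, fun _ => ?_⟩
  have eM : Even M.length := by simp [hM]
  have eN : Even N.length := by simp [hN]
  rw [Q_insert eM eN hd]
  have hv : ∀ i < 2 * k, altSum (c i) (A ++ M ++ B ++ N ++ C) ^ 2
      = (1 + (-1) ^ B.length) ^ 2 := by
    intro i hi
    have hf := hfresh i hi
    simp only [mem_labels_append, not_or] at hf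
    have hs : ∑ j ∈ Finset.range (2 * k), (if c j = c i then (-1 : ℤ) ^ j else 0)
        = (-1) ^ i := by
      rw [Finset.sum_eq_single i]
      · simp
      · intro j hj hji
        rw [if_neg]
        intro hh
        exact hji (hinj j (Finset.mem_range.1 hj) i hi hh)
      · intro hh
        exact absurd (Finset.mem_range.2 hi) hh
    have aM : altSum (c i) M = (-1) ^ i := by rw [hM, altSum_range, hs]
    have aN : altSum (c i) N = (-1) ^ i := by rw [hN, altSum_range, hs]
    have : altSum (c i) (A ++ M ++ B ++ N ++ C)
        = (-1) ^ A.length * (-1) ^ i * (1 + (-1) ^ B.length) := by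
      simp only [altSum_append, aM, aN, altSum_notMem _ _ hf.1.1,
        altSum_notMem _ _ hf.1.2, altSum_notMem _ _ hf.2, List.length_append, pow_add,
        eM.neg_one_pow]
      ring
    rw [this, mul_pow, mul_pow, ← pow_mul, ← pow_mul, mul_comm A.length, mul_comm i,
      pow_mul, pow_mul]
    norm_num
  rw [Qf_append, Qf_range _ c s _ (2 * k) hv]
  have hw : ∃ w : ℤ, (1 + (-1 : ℤ) ^ B.length) ^ 2 = 4 * w := by
    rcases Nat.even_or_odd B.length with h | h
    · exact ⟨1, by rw [h.neg_one_pow]; norm_num⟩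
    · exact ⟨0, by rw [h.neg_one_pow]; norm_num⟩
  obtain ⟨w, hw⟩ := hw
  rw [hw]
  refine (Int.modEq_iff_dvd.2 ⟨-((if s then 1 else -1) * w), ?_⟩)
  push_cast
  ring

lemma good_step (k : ℕ) {L L' : List Endpoint} (h : reidStep L L' ∨ move2k k L L') :
    Good k L L' := by
  rcases h with (h | h | h | h | h) | h
  · exact good_rotate k h
  · exact good_relabel k h
  · exact good_reid1 k h
  · exact good_reid2 k h
  · exact good_reid3 k h
  · exact good_move2k k h

lemma good_rel (k : ℕ) {L L' : List Endpoint} (h : Rel2k k L L') : Good k L L' := by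
  unfold Rel2k Moves at h
  induction h with
  | refl => exact ⟨Iff.rfl, fun _ => Int.ModEq.refl _⟩
  | tail _ h ih =>
    rcases h with h | h
    · have g := good_step k h
      exact ⟨ih.1.trans g.1, fun hL => (ih.2 hL).trans (g.2 (ih.1.1 hL))⟩
    · have g := good_step k h
      exact ⟨ih.1.trans g.1.symm,
        fun hL => (ih.2 hL).trans (g.2 (g.1.2 (ih.1.1 hL))).symm⟩

end Gauss

open Gauss in
/-- if two virtual knots are related by a finite sequence of
2k-moves (k ≥ 1), then their odd writhes are congruent mod 2k. -/
theorem oddWrithe_modEq_of_rel2k (k : ℕ) (hk : 0 < k)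
    (G G' : List Endpoint) (hG : IsGaussDiagram G) (hG' : IsGaussDiagram G')
    (h : Rel2k k G G') :
    oddWrithe G ≡ oddWrithe G' [ZMOD (2 * k : ℤ)] := by
  have hq := (good_rel k h).2 hG
  rw [← four_oddWrithe hG, ← four_oddWrithe hG'] at hq
  have h8 : (8 * k : ℤ) = 4 * (2 * k) := by ring
  rw [h8] at hq
  exact Int.ModEq.mul_left_cancel' (by norm_num) hq
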